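/- (Theorem 4.2) Let ρ be a four-qudit quantum state on (ℂ^d)^{⊗4}, and for an integer k with 1 ≤ k ≤ (d²−1)² define the average Ky Fan k-norm of the three two-vs-two realignments, ‖M_{22}(R^{ABCD})‖_k = (‖M^{(AB)(CD)}‖_k + ‖M^{(AC)(BD)}‖_k + ‖M^{(AD)(BC)}‖_k)/3. If for some such k one has ‖M_{22}(R^{ABCD})‖_k > max{ (d²−1 + 2√k(d²−1))/3 , √k·(d−1)·√((d−1)(d+2)) }, then ρ is genuinely multipartite entangled; equivalently, every biseparable state ρ (every convex combination of pure states each of which is biseparable along some bipartition of the four parties) satisfies ‖M_{22}(R^{ABCD})‖_k ≤ max{ (d²−1 + 2√k(d²−1))/3 , √k·(d−1)·√((d−1)(d+2)) } for all such k. -/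

import Mathlib

open Matrix ComplexOrder

namespace SpinCorrGME

/-- The singular values of a square complex matrix `S`, indexed by the row type:
the square roots of the eigenvalues of the positive semidefinite matrix `Sᴴ * S`. -/
noncomputable def singularValues {n : Type*} [Fintype n] [DecidableEq n]
    (S : Matrix n n ℂ) : n → ℝ :=
  fun i => Real.sqrt ((Matrix.posSemidef_conjTranspose_mul_self S).isHermitian.eigenvalues i)

/-- The Ky Fan `k`-norm of a square complex matrix: the sum of its `k` largest singular
values, expressed as the maximum of `∑ i ∈ t, σ_i` over all subsets `t` of cardinality
`k` (and `0` if `k` exceeds the size of the matrix). -/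
noncomputable def kyFan {n : Type*} [Fintype n] [DecidableEq n] (k : ℕ)
    (S : Matrix n n ℂ) : ℝ :=
  if h : (Finset.powersetCard k (Finset.univ : Finset n)).Nonempty then
    (Finset.powersetCard k (Finset.univ : Finset n)).sup' h
      (fun t => ∑ i ∈ t, singularValues S i)
  else 0

variable {d : ℕ}

/-- Tensor (Kronecker) product of four `d × d` matrices, acting on `(ℂ^d)^{⊗4}`. -/
noncomputable def kron4 (A B C D : Matrix (Fin d) (Fin d) ℂ) :
    Matrix (Fin d × Fin d × Fin d × Fin d) (Fin d × Fin d × Fin d × Fin d) ℂ :=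
  Matrix.of fun p q =>
    A p.1 q.1 * B p.2.1 q.2.1 * C p.2.2.1 q.2.2.1 * D p.2.2.2 q.2.2.2

/-- The rank-one projector `|ψ⟩⟨ψ|` onto a vector of `(ℂ^d)^{⊗4}`. -/
noncomputable def outer (ψ : Fin d × Fin d × Fin d × Fin d → ℂ) :
    Matrix (Fin d × Fin d × Fin d × Fin d) (Fin d × Fin d × Fin d × Fin d) ℂ :=
  Matrix.of fun p q => ψ p * (starRingEnd ℂ) (ψ q)

/-- A vector is normalized (a unit vector). -/
def unitNorm {α : Type*} [Fintype α] (v : α → ℂ) : Prop := ∑ x, ‖v x‖ ^ 2 = 1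

variable (lam : Fin (d ^ 2 - 1) → Matrix (Fin d) (Fin d) ℂ)
variable (ρ : Matrix (Fin d × Fin d × Fin d × Fin d) (Fin d × Fin d × Fin d × Fin d) ℂ)

/-- The realignment `M^{(AB)(CD)}` of the four-body correlation tensor
`R^{ABCD}_{ijlm} = tr(ρ · λ_i ⊗ λ_j ⊗ λ_l ⊗ λ_m)`: rows indexed by `(i,j)`,
columns indexed by `(l,m)`. -/
noncomputable def MABCD :
    Matrix (Fin (d ^ 2 - 1) × Fin (d ^ 2 - 1)) (Fin (d ^ 2 - 1) × Fin (d ^ 2 - 1)) ℂ :=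
  Matrix.of fun p q => (ρ * kron4 (lam p.1) (lam p.2) (lam q.1) (lam q.2)).trace

/-- The realignment `M^{(AC)(BD)}`: rows indexed by `(i,l)`, columns by `(j,m)`. -/
noncomputable def MACBD :
    Matrix (Fin (d ^ 2 - 1) × Fin (d ^ 2 - 1)) (Fin (d ^ 2 - 1) × Fin (d ^ 2 - 1)) ℂ :=
  Matrix.of fun p q => (ρ * kron4 (lam p.1) (lam q.1) (lam p.2) (lam q.2)).trace

/-- The realignment `M^{(AD)(BC)}`: rows indexed by `(i,m)`, columns by `(j,l)`. -/
noncomputable def MADBC :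
    Matrix (Fin (d ^ 2 - 1) × Fin (d ^ 2 - 1)) (Fin (d ^ 2 - 1) × Fin (d ^ 2 - 1)) ℂ :=
  Matrix.of fun p q => (ρ * kron4 (lam p.1) (lam q.1) (lam q.2) (lam p.2)).trace

/-- A pure state of `(ℂ^d)^{⊗4}` is biseparable if it factors (up to ordering of the
tensor factors) as a unit vector on the parties in some nonempty proper subset of
`{A,B,C,D}` tensored with a unit vector on the complementary parties.  There are seven
bipartitions up to complement: the four `1|3` splittings and the three `2|2`
splittings. -/
def BisepPure {d : ℕ} (ψ : Fin d × Fin d × Fin d × Fin d → ℂ) : Prop :=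
  (∃ (φ : Fin d → ℂ) (χ : Fin d × Fin d × Fin d → ℂ), unitNorm φ ∧ unitNorm χ ∧
    ∀ p, ψ p = φ p.1 * χ (p.2.1, p.2.2.1, p.2.2.2)) ∨
  (∃ (φ : Fin d → ℂ) (χ : Fin d × Fin d × Fin d → ℂ), unitNorm φ ∧ unitNorm χ ∧
    ∀ p, ψ p = φ p.2.1 * χ (p.1, p.2.2.1, p.2.2.2)) ∨
  (∃ (φ : Fin d → ℂ) (χ : Fin d × Fin d × Fin d → ℂ), unitNorm φ ∧ unitNorm χ ∧
    ∀ p, ψ p = φ p.2.2.1 * χ (p.1, p.2.1, p.2.2.2)) ∨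
  (∃ (φ : Fin d → ℂ) (χ : Fin d × Fin d × Fin d → ℂ), unitNorm φ ∧ unitNorm χ ∧
    ∀ p, ψ p = φ p.2.2.2 * χ (p.1, p.2.1, p.2.2.1)) ∨
  (∃ (φ χ : Fin d × Fin d → ℂ), unitNorm φ ∧ unitNorm χ ∧
    ∀ p, ψ p = φ (p.1, p.2.1) * χ (p.2.2.1, p.2.2.2)) ∨
  (∃ (φ χ : Fin d × Fin d → ℂ), unitNorm φ ∧ unitNorm χ ∧
    ∀ p, ψ p = φ (p.1, p.2.2.1) * χ (p.2.1, p.2.2.2)) ∨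
  (∃ (φ χ : Fin d × Fin d → ℂ), unitNorm φ ∧ unitNorm χ ∧
    ∀ p, ψ p = φ (p.1, p.2.2.2) * χ (p.2.1, p.2.2.1))

/-- A mixed state of `(ℂ^d)^{⊗4}` is biseparable if it is a convex combination of
projectors onto biseparable pure states (possibly along different bipartitions). -/
def Biseparable {d : ℕ}
    (ρ : Matrix (Fin d × Fin d × Fin d × Fin d) (Fin d × Fin d × Fin d × Fin d) ℂ) :
    Prop :=
  ∃ (n : ℕ) (p : Fin n → ℝ) (ψ : Fin n → (Fin d × Fin d × Fin d × Fin d → ℂ)),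
    (∀ α, 0 ≤ p α) ∧ (∑ α, p α = 1) ∧ (∀ α, BisepPure (ψ α)) ∧
    ρ = ∑ α, (p α : ℂ) • outer (ψ α)

/-- Cauchy-Schwarz for finite sums of complex numbers. -/
lemma norm_sum_mul_le_sqrt {α : Type*} [Fintype α] (f g : α → ℂ) :
    ‖∑ a, f a * g a‖ ≤ √(∑ a, ‖f a‖ ^ 2) * √(∑ a, ‖g a‖ ^ 2) := by
  refine (norm_sum_le _ _).trans ?_
  simp only [norm_mul]
  exact Real.sum_mul_le_sqrt_mul_sqrt _ _ _

/-- The squared Frobenius norm of a matrix as a trace. -/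
lemma trace_mul_conjTranspose_eq_sum_sq {m n : Type*} [Fintype m] [Fintype n]
    (A : Matrix m n ℂ) : (A * Aᴴ).trace = ((∑ i, ∑ j, ‖A i j‖ ^ 2 : ℝ) : ℂ) := by
  simp [Matrix.trace, Matrix.mul_apply, Complex.mul_conj']

/-- The squared Euclidean norm of a row vector multiplied by a matrix. -/
lemma sum_sq_vecMul {m n : Type*} [Fintype m] [Fintype n] (y : m → ℂ)
    (A : Matrix m n ℂ) :
    ((∑ j, ‖(y ᵥ* A) j‖ ^ 2 : ℝ) : ℂ) = (y ᵥ* (A * Aᴴ)) ⬝ᵥ star y := by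
  rw [← Matrix.vecMul_vecMul, ← Matrix.dotProduct_mulVec, ← Matrix.star_vecMul]
  simp [dotProduct, Complex.mul_conj']

/-- The Ky Fan norm is attained by pairing with a contraction of squared Frobenius norm at
most `k`. -/
lemma exists_kyFan_eq_trace {n : Type*} [Fintype n] [DecidableEq n] (k : ℕ)
    (S : Matrix n n ℂ) :
    ∃ W : Matrix n n ℂ, kyFan k S = (W * S).trace.re ∧
      ∑ i, ∑ j, ‖W i j‖ ^ 2 ≤ (k : ℝ) ∧
      ∀ y : n → ℂ, ∑ j, ‖(y ᵥ* W) j‖ ^ 2 ≤ ∑ i, ‖y i‖ ^ 2 := by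
  by_cases h : (Finset.powersetCard k (Finset.univ : Finset n)).Nonempty
  swap
  · exact ⟨0, by simp [kyFan, h], by simp, fun y => by simp; positivity⟩
  obtain ⟨t, ht, hsup⟩ := Finset.exists_mem_eq_sup' h
    (fun t => ∑ i ∈ t, singularValues S i)
  have hcard : t.card = k := (Finset.mem_powersetCard.1 ht).2
  set hA := (Matrix.posSemidef_conjTranspose_mul_self S).isHermitian
  set V : Matrix n n ℂ := hA.eigenvectorUnitary.1
  have hV1 : V * Vᴴ = 1 := Unitary.coe_mul_star_self _
  have hspec : Vᴴ * (Sᴴ * S) * V = diagonal (fun i => (hA.eigenvalues i : ℂ)) := by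
    have := hA.conjStarAlgAut_star_eigenvectorUnitary
    rw [Unitary.conjStarAlgAut_star_apply] at this
    exact this
  have hσ : ∀ i, hA.eigenvalues i = singularValues S i ^ 2 := fun i =>
    (Real.sq_sqrt ((Matrix.posSemidef_conjTranspose_mul_self S).eigenvalues_nonneg i)).symm
  set σ := singularValues S
  set c : n → ℝ := fun i => if i ∈ t then (σ i)⁻¹ else 0 with hc
  set e : n → ℝ := fun i => c i * σ i ^ 2 * c i with he
  have he1 : ∀ i, e i ≤ if i ∈ t then 1 else 0 := by
    intro i
    simp only [he, hc]
    split_ifs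
    · rcases eq_or_ne (σ i) 0 with h0 | h0
      · simp [h0]
      · field_simp; exact le_rfl
    · simp
  set D : Matrix n n ℂ := diagonal fun i => (c i : ℂ)
  have hDH : Dᴴ = D := by
    simp only [D, diagonal_conjTranspose]
    congr 1
    ext i
    simp
  have hWW : (V * D * Vᴴ * Sᴴ) * (V * D * Vᴴ * Sᴴ)ᴴ
      = V * diagonal (fun i => (e i : ℂ)) * Vᴴ := by
    have h1 : D * (Vᴴ * (Sᴴ * S) * V) * D = diagonal fun i => (e i : ℂ) := by
      rw [hspec]
      simp only [D, diagonal_mul_diagonal, hσ, he]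
      push_cast
      rfl
    rw [← h1]
    simp only [conjTranspose_mul, conjTranspose_conjTranspose, hDH, Matrix.mul_assoc]
  refine ⟨V * D * Vᴴ * Sᴴ, ?_, ?_, ?_⟩
  · have h1 : (V * D * Vᴴ * Sᴴ * S).trace = (D * (Vᴴ * (Sᴴ * S) * V)).trace := by
      rw [show V * D * Vᴴ * Sᴴ * S = V * (D * (Vᴴ * (Sᴴ * S))) by
        simp only [Matrix.mul_assoc], Matrix.trace_mul_comm]
      simp only [Matrix.mul_assoc]
    have h2 : ∀ i, c i * σ i ^ 2 = if i ∈ t then σ i else 0 := by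
      intro i
      simp only [hc]
      split_ifs
      · rcases eq_or_ne (σ i) 0 with h0 | h0
        · simp [h0]
        · field_simp
      · simp
    rw [h1, hspec]
    simp only [D, diagonal_mul_diagonal, trace_diagonal, hσ, kyFan, h, dif_pos]
    simp only [← Complex.ofReal_mul, ← Complex.ofReal_sum, Complex.ofReal_re, h2]
    simpa using hsup
  · have h1 := trace_mul_conjTranspose_eq_sum_sq (V * D * Vᴴ * Sᴴ)
    rw [hWW, Matrix.mul_assoc, Matrix.trace_mul_comm, Matrix.mul_assoc,
      show Vᴴ * V = 1 from Unitary.coe_star_mul_self _, Matrix.mul_one, trace_diagonal] at h1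
    have h2 : ∑ i, e i = ∑ i, ∑ j, ‖(V * D * Vᴴ * Sᴴ) i j‖ ^ 2 := by exact_mod_cast h1
    rw [← h2]
    refine (Finset.sum_le_sum fun i _ => he1 i).trans ?_
    simp [hcard]
  · intro y
    have h1 := sum_sq_vecMul y (V * D * Vᴴ * Sᴴ)
    have h2 := sum_sq_vecMul y V
    rw [hV1, Matrix.vecMul_one] at h2
    have hE : (y ᵥ* (V * diagonal (fun i => (e i : ℂ)) * Vᴴ)) ⬝ᵥ star y
        = ((y ᵥ* V) ᵥ* diagonal (fun i => (e i : ℂ))) ⬝ᵥ star (y ᵥ* V) := by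
      rw [← Matrix.vecMul_vecMul, ← Matrix.dotProduct_mulVec, ← Matrix.star_vecMul,
        ← Matrix.vecMul_vecMul]
    rw [hWW, hE] at h1
    have h3 : ∑ j, ‖(y ᵥ* (V * D * Vᴴ * Sᴴ)) j‖ ^ 2 = ∑ i, e i * ‖(y ᵥ* V) i‖ ^ 2 := by
      apply Complex.ofReal_injective
      rw [h1]
      push_cast
      simp only [dotProduct, vecMul_diagonal, Pi.star_apply, RCLike.star_def]
      refine Finset.sum_congr rfl fun i _ => ?_
      rw [← Complex.mul_conj']
      ring
    have h4 : ∑ i, ‖(y ᵥ* V) i‖ ^ 2 = ∑ i, ‖y i‖ ^ 2 := by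
      apply Complex.ofReal_injective
      rw [h2]
      simp [dotProduct, Complex.mul_conj']
    rw [h3, ← h4]
    refine Finset.sum_le_sum fun i _ => ?_
    have : e i ≤ 1 := (he1 i).trans (by split_ifs <;> norm_num)
    exact mul_le_of_le_one_left (by positivity) this

/-- Pairing with a matrix of squared Frobenius norm at most `k`. -/
lemma re_trace_mul_le_frobenius {n : Type*} [Fintype n] {k F : ℝ} {W : Matrix n n ℂ}
    (hW : ∑ i, ∑ j, ‖W i j‖ ^ 2 ≤ k) {M : Matrix n n ℂ}
    (hM : ∑ i, ∑ j, ‖M i j‖ ^ 2 ≤ F) : (W * M).trace.re ≤ √k * √F := by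
  have h := norm_sum_mul_le_sqrt (fun x : n × n => W x.1 x.2) (fun x => M x.2 x.1)
  simp only [Fintype.sum_prod_type] at h
  rw [Finset.sum_comm (f := fun x y => ‖M y x‖ ^ 2)] at h
  refine (Complex.re_le_norm _).trans ?_
  simp only [Matrix.trace, Matrix.diag_apply, Matrix.mul_apply]
  exact h.trans (by gcongr)

/-- Pairing a contraction with a rank-one matrix. -/
lemma re_trace_mul_le_rankOne {n : Type*} [Fintype n] {W : Matrix n n ℂ}
    (hW : ∀ y : n → ℂ, ∑ j, ‖(y ᵥ* W) j‖ ^ 2 ≤ ∑ i, ‖y i‖ ^ 2) {M : Matrix n n ℂ}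
    {x y : n → ℂ} (hM : ∀ i j, M i j = x i * y j) {a b : ℝ}
    (hx : ∑ i, ‖x i‖ ^ 2 ≤ a) (hy : ∑ i, ‖y i‖ ^ 2 ≤ b) :
    (W * M).trace.re ≤ √b * √a := by
  have h := norm_sum_mul_le_sqrt (y ᵥ* W) x
  have h1 : (W * M).trace = ∑ j, (y ᵥ* W) j * x j := by
    simp only [Matrix.trace, Matrix.diag_apply, Matrix.mul_apply, Matrix.vecMul, dotProduct,
      Finset.sum_mul, hM]
    rw [Finset.sum_comm]
    refine Finset.sum_congr rfl fun i _ => Finset.sum_congr rfl fun j _ => by ring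
  rw [h1]
  refine (Complex.re_le_norm _).trans (h.trans ?_)
  gcongr
  exact (hW y).trans hy

section CorrelationTensor

open scoped Kronecker

/-- The quadratic form `⟨v|K|v⟩ = tr(|v⟩⟨v| K)` of a matrix `K` at a vector `v`. -/
noncomputable def expect {α : Type*} [Fintype α] (v : α → ℂ) (K : Matrix α α ℂ) : ℂ :=
  ∑ p, ∑ q, v p * (starRingEnd ℂ) (v q) * K q p

lemma trace_outer_mul {d : ℕ} (ψ : Fin d × Fin d × Fin d × Fin d → ℂ)
    (K : Matrix (Fin d × Fin d × Fin d × Fin d) (Fin d × Fin d × Fin d × Fin d) ℂ) :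
    (outer ψ * K).trace = expect ψ K := by
  simp [Matrix.trace, Matrix.mul_apply, outer, expect]

lemma expect_equiv {α β : Type*} [Fintype α] [Fintype β] (e : α ≃ β) (v : β → ℂ)
    (K : Matrix β β ℂ) : expect (v ∘ e) (K.submatrix e e) = expect v K := by
  unfold expect
  rw [← Equiv.sum_comp e]
  refine Finset.sum_congr rfl fun p _ => ?_
  rw [← Equiv.sum_comp e]
  rfl

lemma expect_prod {α β : Type*} [Fintype α] [Fintype β] (φ : α → ℂ) (χ : β → ℂ)
    (A : Matrix α α ℂ) (B : Matrix β β ℂ) :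
    expect (fun p : α × β => φ p.1 * χ p.2) (A ⊗ₖ B) = expect φ A * expect χ B := by
  unfold expect
  rw [Finset.sum_mul_sum, Fintype.sum_prod_type]
  refine Finset.sum_congr rfl fun a _ => Finset.sum_congr rfl fun b _ => ?_
  rw [Finset.sum_mul_sum, Fintype.sum_prod_type]
  refine Finset.sum_congr rfl fun a' _ => Finset.sum_congr rfl fun b' _ => ?_
  simp only [kroneckerMap_apply, map_mul]
  ring

lemma expect_one {α : Type*} [Fintype α] [DecidableEq α] {v : α → ℂ} (hv : unitNorm v) :
    expect v 1 = 1 := by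
  unfold expect
  simp only [Matrix.one_apply, mul_ite, mul_one, mul_zero, Finset.sum_ite_eq',
    Finset.mem_univ, if_true, Complex.mul_conj']
  exact_mod_cast hv

/-- A Hermitian operator basis of the `α × α` matrices, orthogonal for the trace form and
normalized to `tr(μ_i ^ 2) = |α|`. -/
structure IsOpBasis {α ι : Type*} [Fintype α] [Fintype ι] [DecidableEq ι]
    (μ : ι → Matrix α α ℂ) : Prop where
  pos : 0 < Fintype.card α
  card : Fintype.card ι = Fintype.card α ^ 2
  herm : ∀ i, (μ i).IsHermitian
  orth : ∀ i j, (μ i * μ j).trace = if i = j then (Fintype.card α : ℂ) else 0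

lemma IsOpBasis.kronecker {α β ι κ : Type*} [Fintype α] [Fintype β] [Fintype ι] [Fintype κ]
    [DecidableEq ι] [DecidableEq κ] {μ : ι → Matrix α α ℂ} {ν : κ → Matrix β β ℂ}
    (hμ : IsOpBasis μ) (hν : IsOpBasis ν) :
    IsOpBasis (fun x : ι × κ => μ x.1 ⊗ₖ ν x.2) where
  pos := by rw [Fintype.card_prod]; exact Nat.mul_pos hμ.pos hν.pos
  card := by rw [Fintype.card_prod, Fintype.card_prod, hμ.card, hν.card]; ring
  herm x := by
    rw [Matrix.IsHermitian, conjTranspose_kronecker, (hμ.herm _).eq, (hν.herm _).eq]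
  orth x y := by
    rw [← mul_kronecker_mul, trace_kronecker, hμ.orth, hν.orth, Fintype.card_prod]
    by_cases h1 : x.1 = y.1 <;> by_cases h2 : x.2 = y.2 <;> simp [h1, h2, Prod.ext_iff]

/-- Parseval's identity for an operator basis. -/
lemma IsOpBasis.parseval {α ι : Type*} [Fintype α] [Fintype ι] [DecidableEq ι]
    {μ : ι → Matrix α α ℂ} (hμ : IsOpBasis μ) (f : α → α → ℂ) :
    ∑ i, ‖∑ a, ∑ b, f a b * μ i b a‖ ^ 2 = Fintype.card α * ∑ a, ∑ b, ‖f a b‖ ^ 2 := by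
  classical
  set N : ℂ := (Fintype.card α : ℂ)
  have hN : N ≠ 0 := Nat.cast_ne_zero.2 hμ.pos.ne'
  let A : Matrix (α × α) ι ℂ := Matrix.of fun p i => μ i p.2 p.1
  have h0 : Aᴴ * A = N • (1 : Matrix ι ι ℂ) := by
    ext i j
    have := hμ.orth i j
    simp only [Matrix.trace, Matrix.diag_apply, Matrix.mul_apply] at this
    simp only [Matrix.smul_apply, Matrix.mul_apply, conjTranspose_apply,
      Matrix.of_apply, A, Fintype.sum_prod_type, smul_eq_mul, (hμ.herm i).apply, this,
      Matrix.one_apply, mul_ite, mul_one, mul_zero, N]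
  have h1 : Aᴴ * (N⁻¹ • A) = 1 := by
    rw [Matrix.mul_smul, h0, smul_smul, inv_mul_cancel₀ hN, one_smul]
  have h2 : A * Aᴴ = N • (1 : Matrix (α × α) (α × α) ℂ) := by
    have hc : Fintype.card ι = Fintype.card (α × α) := by rw [hμ.card, Fintype.card_prod, sq]
    have h1' := (Matrix.mul_eq_one_comm_of_card_eq _ _ _ hc).1 h1
    rw [← h1', Matrix.smul_mul, smul_smul, mul_inv_cancel₀ hN, one_smul]
  have h3 := sum_sq_vecMul (fun p : α × α => f p.1 p.2) A
  rw [h2] at h3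
  apply Complex.ofReal_injective
  have h4 : ∀ i, ((fun p : α × α => f p.1 p.2) ᵥ* A) i = ∑ a, ∑ b, f a b * μ i b a := by
    intro i
    simp [Matrix.vecMul, dotProduct, A, Fintype.sum_prod_type]
  simp only [h4] at h3
  rw [h3, Matrix.vecMul_smul, Matrix.vecMul_one, smul_dotProduct]
  simp [dotProduct, Complex.mul_conj', Fintype.sum_prod_type, N]

lemma IsOpBasis.sum_expect_sq {α ι : Type*} [Fintype α] [Fintype ι] [DecidableEq ι]
    {μ : ι → Matrix α α ℂ} (hμ : IsOpBasis μ) {v : α → ℂ} (hv : unitNorm v) :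
    ∑ i, ‖expect v (μ i)‖ ^ 2 = Fintype.card α := by
  unfold expect
  rw [hμ.parseval (fun p q => v p * (starRingEnd ℂ) (v q))]
  simp only [norm_mul, RCLike.norm_conj, mul_pow, ← Finset.mul_sum]
  rw [← Finset.sum_mul]
  simp only [unitNorm] at hv
  simp [hv]

lemma sum_sq_mul_conjTranspose {m n : Type*} [Fintype m] [Fintype n] (A : Matrix m n ℂ) :
    ∑ a, ∑ a', ‖(A * Aᴴ) a a'‖ ^ 2 = ∑ b, ∑ b', ‖(Aᴴ * A) b b'‖ ^ 2 := by
  apply Complex.ofReal_injective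
  rw [← trace_mul_conjTranspose_eq_sum_sq, ← trace_mul_conjTranspose_eq_sum_sq]
  simp only [conjTranspose_mul, conjTranspose_conjTranspose, Matrix.mul_assoc]
  rw [Matrix.trace_mul_comm]
  simp only [Matrix.mul_assoc]

/-- The two marginals of a pure bipartite state have equal purities. -/
lemma IsOpBasis.marginals {α β ι κ : Type*} [Fintype α] [Fintype β] [Fintype ι] [Fintype κ]
    [DecidableEq α] [DecidableEq β]
    [DecidableEq ι] [DecidableEq κ] {μ : ι → Matrix α α ℂ} {ν : κ → Matrix β β ℂ}
    (hμ : IsOpBasis μ) (hν : IsOpBasis ν) (v : α × β → ℂ) :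
    Fintype.card β * ∑ i, ‖expect v (μ i ⊗ₖ 1)‖ ^ 2 =
      Fintype.card α * ∑ j, ‖expect v (1 ⊗ₖ ν j)‖ ^ 2 := by
  let A : Matrix α β ℂ := Matrix.of fun a b => v (a, b)
  have h1 : ∀ i, expect v (μ i ⊗ₖ 1) = ∑ a, ∑ a', (A * Aᴴ) a a' * μ i a' a := by
    intro i
    simp only [expect, Fintype.sum_prod_type, kroneckerMap_apply, Matrix.one_apply, mul_ite,
      mul_one, mul_zero, Finset.sum_ite_eq', Finset.mem_univ, if_true, Matrix.mul_apply,
      conjTranspose_apply, A, Matrix.of_apply, Finset.sum_mul, RCLike.star_def]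
    exact Finset.sum_congr rfl fun a _ => Finset.sum_comm
  have h2 : ∀ j, expect v (1 ⊗ₖ ν j) = ∑ b, ∑ b', (Aᴴ * A) b' b * ν j b' b := by
    intro j
    simp only [expect, Fintype.sum_prod_type, kroneckerMap_apply, Matrix.one_apply, ite_mul,
      one_mul, zero_mul, mul_ite, mul_zero, Matrix.mul_apply,
      conjTranspose_apply, A, Matrix.of_apply, Finset.sum_mul, RCLike.star_def]
    rw [Finset.sum_comm]
    refine Finset.sum_congr rfl fun b _ => ?_
    have : ∀ a : α, ∑ a', ∑ b', (if a' = a then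
        v (a, b) * (starRingEnd ℂ) (v (a', b')) * ν j b' b else 0)
        = ∑ b', v (a, b) * (starRingEnd ℂ) (v (a, b')) * ν j b' b := by
      intro a
      rw [Finset.sum_comm]
      simp
    simp only [this]
    rw [Finset.sum_comm]
    exact Finset.sum_congr rfl fun b' _ => Finset.sum_congr rfl fun a _ => by ring
  simp only [h1, h2]
  rw [hμ.parseval (fun a a' => (A * Aᴴ) a a'),
    hν.parseval (fun b b' => (Aᴴ * A) b' b), sum_sq_mul_conjTranspose,
    Finset.sum_comm (f := fun b b' => ‖(Aᴴ * A) b b'‖ ^ 2)]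
  ring

/-- The identity adjoined to a family of matrices. -/
def withOne {d : ℕ} {m : Type*} (L : m → Matrix (Fin d) (Fin d) ℂ) :
    Option m → Matrix (Fin d) (Fin d) ℂ :=
  fun o => o.elim 1 L

lemma isOpBasis_withOne {d : ℕ} (hd : 2 ≤ d) {L : Fin (d ^ 2 - 1) → Matrix (Fin d) (Fin d) ℂ}
    (hherm : ∀ i, (L i).IsHermitian) (htr0 : ∀ i, (L i).trace = 0)
    (horth : ∀ i j, (L i * L j).trace = if i = j then (d : ℂ) else 0) :
    IsOpBasis (withOne L) where
  pos := by simp; omega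
  card := by
    have : 0 < d ^ 2 := by positivity
    simp
    omega
  herm i := by
    cases i
    · exact Matrix.isHermitian_one
    · exact hherm _
  orth i j := by
    cases i <;> cases j <;> simp [withOne, htr0, horth]

variable {m : Type*} [Fintype m] [DecidableEq m]

lemma one_body_bound {d : ℕ} {L : m → Matrix (Fin d) (Fin d) ℂ} (hL : IsOpBasis (withOne L))
    {φ : Fin d → ℂ} (hφ : unitNorm φ) : ∑ i, ‖expect φ (L i)‖ ^ 2 ≤ (d : ℝ) - 1 := by
  have h := hL.sum_expect_sq hφ
  simp only [Fintype.sum_option, withOne, Option.elim, expect_one hφ] at h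
  simp at h
  linarith

lemma two_body_bound {d : ℕ} {L : m → Matrix (Fin d) (Fin d) ℂ} (hL : IsOpBasis (withOne L))
    {φ : Fin d × Fin d → ℂ} (hφ : unitNorm φ) :
    ∑ x : m × m, ‖expect φ (L x.1 ⊗ₖ L x.2)‖ ^ 2 ≤ (d : ℝ) ^ 2 - 1 := by
  have h := (hL.kronecker hL).sum_expect_sq hφ
  simp only [Fintype.sum_option, Fintype.sum_prod_type, withOne, Option.elim,
    one_kronecker_one, expect_one hφ, Finset.sum_add_distrib, Fintype.card_prod,
    Fintype.card_fin, Nat.cast_mul] at h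
  rw [Fintype.sum_prod_type]
  have h1 : 0 ≤ ∑ i, ‖expect φ (L i ⊗ₖ 1)‖ ^ 2 := by positivity
  have h2 : 0 ≤ ∑ i, ‖expect φ (1 ⊗ₖ L i)‖ ^ 2 := by positivity
  norm_num at h
  linarith

lemma three_body_bound {d : ℕ} {L : m → Matrix (Fin d) (Fin d) ℂ}
    (hL : IsOpBasis (withOne L)) {χ : Fin d × Fin d × Fin d → ℂ} (hχ : unitNorm χ) :
    ∑ x : m × m × m, ‖expect χ (L x.1 ⊗ₖ (L x.2.1 ⊗ₖ L x.2.2))‖ ^ 2 ≤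
      (d : ℝ) ^ 3 - 3 * d + 2 := by
  have hd0 : 0 < d := by simpa using hL.pos
  have hd1 : (1 : ℝ) ≤ d := by exact_mod_cast hd0
  have h := (hL.kronecker (hL.kronecker hL)).sum_expect_sq hχ
  let e2 : Fin d × Fin d × Fin d ≃ Fin d × Fin d × Fin d :=
    ⟨fun p => (p.2.1, p.1, p.2.2), fun p => (p.2.1, p.1, p.2.2), fun _ => rfl, fun _ => rfl⟩
  let e3 : Fin d × Fin d × Fin d ≃ Fin d × Fin d × Fin d :=
    ⟨fun p => (p.2.2, p.2.1, p.1), fun p => (p.2.2, p.2.1, p.1), fun _ => rfl, fun _ => rfl⟩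
  have hB : ∀ X Y Z : Matrix (Fin d) (Fin d) ℂ,
      expect (χ ∘ e2) (X ⊗ₖ (Y ⊗ₖ Z)) = expect χ (Y ⊗ₖ (X ⊗ₖ Z)) := by
    intro X Y Z
    rw [← expect_equiv e2 χ]
    congr 1
    ext p q
    simp [e2]
    ring
  have hC : ∀ X Y Z : Matrix (Fin d) (Fin d) ℂ,
      expect (χ ∘ e3) (X ⊗ₖ (Y ⊗ₖ Z)) = expect χ (Z ⊗ₖ (Y ⊗ₖ X)) := by
    intro X Y Z
    rw [← expect_equiv e3 χ]
    congr 1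
    ext p q
    simp [e3]
    ring
  have mA := hL.marginals (hL.kronecker hL) χ
  have mB := hL.marginals (hL.kronecker hL) (χ ∘ e2)
  have mC := hL.marginals (hL.kronecker hL) (χ ∘ e3)
  simp only [← one_kronecker_one (α := ℂ) (m := Fin d) (n := Fin d), hB, hC] at mA mB mC
  have h1 : expect χ ((1 : Matrix (Fin d) (Fin d) ℂ) ⊗ₖ
      ((1 : Matrix (Fin d) (Fin d) ℂ) ⊗ₖ (1 : Matrix (Fin d) (Fin d) ℂ))) = 1 := by
    rw [one_kronecker_one, one_kronecker_one, expect_one hχ]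
  simp only [Fintype.sum_option, Fintype.sum_prod_type, withOne, Option.elim,
    h1, Finset.sum_add_distrib, Fintype.card_prod,
    Fintype.card_fin, Nat.cast_mul, norm_one, one_pow] at h mA mB mC
  simp only [Fintype.sum_prod_type]
  set sA := ∑ i, ‖expect χ (L i ⊗ₖ (1 ⊗ₖ 1))‖ ^ 2
  set sB := ∑ i, ‖expect χ (1 ⊗ₖ (L i ⊗ₖ 1))‖ ^ 2
  set sC := ∑ i, ‖expect χ (1 ⊗ₖ (1 ⊗ₖ L i))‖ ^ 2
  have hsA : 0 ≤ sA := by positivity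
  have hsB : 0 ≤ sB := by positivity
  have hsC : 0 ≤ sC := by positivity
  have hd' : (d : ℝ) ≠ 0 := by positivity
  rw [mul_assoc] at mA mB mC
  replace mA := mul_left_cancel₀ hd' mA
  replace mB := mul_left_cancel₀ hd' mB
  replace mC := mul_left_cancel₀ hd' mC
  rw [Finset.sum_comm (f := fun x y => ‖expect χ (L y ⊗ₖ (L x ⊗ₖ 1))‖ ^ 2)] at mC
  have hS : 0 ≤ ((d : ℝ) - 1) * (sA + sB + sC) := mul_nonneg (by linarith) (by positivity)
  linarith

section Splittings

variable (α : Type*)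

/-- Split off the first of four factors. -/
def splitA : α × α × α × α ≃ α × (α × α × α) := Equiv.refl _

/-- Split off the second of four factors. -/
def splitB : α × α × α × α ≃ α × (α × α × α) where
  toFun p := (p.2.1, (p.1, p.2.2.1, p.2.2.2))
  invFun p := (p.2.1, p.1, p.2.2.1, p.2.2.2)
  left_inv _ := rfl
  right_inv _ := rfl

/-- Split off the third of four factors. -/
def splitC : α × α × α × α ≃ α × (α × α × α) where
  toFun p := (p.2.2.1, (p.1, p.2.1, p.2.2.2))
  invFun p := (p.2.1, p.2.2.1, p.1, p.2.2.2)
  left_inv _ := rfl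
  right_inv _ := rfl

/-- Split off the fourth of four factors. -/
def splitD : α × α × α × α ≃ α × (α × α × α) where
  toFun p := (p.2.2.2, (p.1, p.2.1, p.2.2.1))
  invFun p := (p.2.1, p.2.2.1, p.2.2.2, p.1)
  left_inv _ := rfl
  right_inv _ := rfl

/-- Group four factors as first and second versus third and fourth. -/
def splitAB : α × α × α × α ≃ (α × α) × (α × α) where
  toFun p := ((p.1, p.2.1), (p.2.2.1, p.2.2.2))
  invFun p := (p.1.1, p.1.2, p.2.1, p.2.2)
  left_inv _ := rfl
  right_inv _ := rfl

/-- Group four factors as first and third versus second and fourth. -/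
def splitAC : α × α × α × α ≃ (α × α) × (α × α) where
  toFun p := ((p.1, p.2.2.1), (p.2.1, p.2.2.2))
  invFun p := (p.1.1, p.2.1, p.1.2, p.2.2)
  left_inv _ := rfl
  right_inv _ := rfl

/-- Group four factors as first and fourth versus second and third. -/
def splitAD : α × α × α × α ≃ (α × α) × (α × α) where
  toFun p := ((p.1, p.2.2.2), (p.2.1, p.2.2.1))
  invFun p := (p.1.1, p.2.1, p.2.2, p.1.2)
  left_inv _ := rfl
  right_inv _ := rfl

end Splittings

/-- The four-body correlation tensor. -/
noncomputable def corr {d : ℕ} {m : Type*} (L : m → Matrix (Fin d) (Fin d) ℂ)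
    (σ : Matrix (Fin d × Fin d × Fin d × Fin d) (Fin d × Fin d × Fin d × Fin d) ℂ)
    (x : m × m × m × m) : ℂ :=
  (σ * kron4 (L x.1) (L x.2.1) (L x.2.2.1) (L x.2.2.2)).trace

/-- The realignment of a four-index tensor along a grouping of its indices. -/
def realign {m : Type*} (s : m × m × m × m ≃ (m × m) × (m × m)) (R : m × m × m × m → ℂ) :
    Matrix (m × m) (m × m) ℂ :=
  Matrix.of fun p q => R (s.symm (p, q))

/-- The correlation tensor of a product vector factorizes. -/
lemma trace_outer_mul_kron4 {d : ℕ} {β γ : Type*} [Fintype β] [Fintype γ]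
    (e : Fin d × Fin d × Fin d × Fin d ≃ β × γ) {ψ : Fin d × Fin d × Fin d × Fin d → ℂ}
    {φ : β → ℂ} {χ : γ → ℂ} (hψ : ∀ p, ψ p = φ (e p).1 * χ (e p).2)
    {A B C D : Matrix (Fin d) (Fin d) ℂ} {X : Matrix β β ℂ} {Y : Matrix γ γ ℂ}
    (hK : ∀ p q, kron4 A B C D p q = X (e p).1 (e q).1 * Y (e p).2 (e q).2) :
    (outer ψ * kron4 A B C D).trace = expect φ X * expect χ Y := by
  rw [trace_outer_mul, ← expect_prod, ← expect_equiv e]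
  congr 1
  · ext p
    exact hψ p
  · ext p q
    exact hK p q

lemma sum_sq_realign {m : Type*} [Fintype m] (s : m × m × m × m ≃ (m × m) × (m × m))
    (R : m × m × m × m → ℂ) :
    ∑ p, ∑ q, ‖realign s R p q‖ ^ 2 = ∑ x, ‖R x‖ ^ 2 := by
  rw [← Equiv.sum_comp s.symm (fun x => ‖R x‖ ^ 2),
    Fintype.sum_prod_type (fun y => ‖R (s.symm y)‖ ^ 2)]
  rfl

lemma sum_sq_le_of_factor {m β γ : Type*} [Fintype m] [Fintype β] [Fintype γ]
    (s : m × m × m × m ≃ β × γ) {R : m × m × m × m → ℂ} {u : β → ℂ} {v : γ → ℂ}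
    (hR : ∀ x, R x = u (s x).1 * v (s x).2) {a b : ℝ} (hu : ∑ i, ‖u i‖ ^ 2 ≤ a)
    (hv : ∑ j, ‖v j‖ ^ 2 ≤ b) : ∑ x, ‖R x‖ ^ 2 ≤ a * b := by
  simp only [hR]
  rw [Equiv.sum_comp s (fun y => ‖u y.1 * v y.2‖ ^ 2), Fintype.sum_prod_type]
  simp only [norm_mul, mul_pow]
  rw [← Finset.sum_mul_sum]
  have : 0 ≤ ∑ i, ‖u i‖ ^ 2 := by positivity
  have : 0 ≤ ∑ j, ‖v j‖ ^ 2 := by positivity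
  gcongr
  linarith

/-- A product vector across a one-versus-three splitting has a correlation tensor of bounded
Frobenius norm. -/
lemma sum_sq_corr_one_three {d : ℕ} {L : m → Matrix (Fin d) (Fin d) ℂ}
    (hL : IsOpBasis (withOne L))
    (e : Fin d × Fin d × Fin d × Fin d ≃ Fin d × (Fin d × Fin d × Fin d))
    (s : m × m × m × m ≃ m × (m × m × m)) {ψ : Fin d × Fin d × Fin d × Fin d → ℂ}
    {φ : Fin d → ℂ} {χ : Fin d × Fin d × Fin d → ℂ} (hφ : unitNorm φ) (hχ : unitNorm χ)
    (hψ : ∀ p, ψ p = φ (e p).1 * χ (e p).2)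
    (hK : ∀ x p q, kron4 (L x.1) (L x.2.1) (L x.2.2.1) (L x.2.2.2) p q =
      L (s x).1 (e p).1 (e q).1 *
        (L (s x).2.1 ⊗ₖ (L (s x).2.2.1 ⊗ₖ L (s x).2.2.2)) (e p).2 (e q).2) :
    ∑ x, ‖corr L (outer ψ) x‖ ^ 2 ≤ ((d : ℝ) - 1) * ((d : ℝ) ^ 3 - 3 * d + 2) :=
  sum_sq_le_of_factor s (u := fun i => expect φ (L i))
    (v := fun y => expect χ (L y.1 ⊗ₖ (L y.2.1 ⊗ₖ L y.2.2)))
    (fun x => trace_outer_mul_kron4 e hψ (hK x))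
    (one_body_bound hL hφ) (three_body_bound hL hχ)

/-- The correlation tensor of a product vector across a two-versus-two splitting. -/
lemma exists_factor_corr_two_two {d : ℕ} {L : m → Matrix (Fin d) (Fin d) ℂ}
    (hL : IsOpBasis (withOne L))
    (e : Fin d × Fin d × Fin d × Fin d ≃ (Fin d × Fin d) × (Fin d × Fin d))
    (s : m × m × m × m ≃ (m × m) × (m × m)) {ψ : Fin d × Fin d × Fin d × Fin d → ℂ}
    {φ χ : Fin d × Fin d → ℂ} (hφ : unitNorm φ) (hχ : unitNorm χ)
    (hψ : ∀ p, ψ p = φ (e p).1 * χ (e p).2)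
    (hK : ∀ x p q, kron4 (L x.1) (L x.2.1) (L x.2.2.1) (L x.2.2.2) p q =
      (L (s x).1.1 ⊗ₖ L (s x).1.2) (e p).1 (e q).1 *
        (L (s x).2.1 ⊗ₖ L (s x).2.2) (e p).2 (e q).2) :
    ∃ u v : m × m → ℂ, (∀ x, corr L (outer ψ) x = u (s x).1 * v (s x).2) ∧
      ∑ i, ‖u i‖ ^ 2 ≤ (d : ℝ) ^ 2 - 1 ∧ ∑ i, ‖v i‖ ^ 2 ≤ (d : ℝ) ^ 2 - 1 :=
  ⟨fun y => expect φ (L y.1 ⊗ₖ L y.2), fun y => expect χ (L y.1 ⊗ₖ L y.2),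
    fun x => trace_outer_mul_kron4 e hψ (hK x), two_body_bound hL hφ, two_body_bound hL hχ⟩

/-- A contraction whose squared Frobenius norm is at most `k`. -/
structure IsDual {n : Type*} [Fintype n] (k : ℕ) (W : Matrix n n ℂ) : Prop where
  frobenius : ∑ i, ∑ j, ‖W i j‖ ^ 2 ≤ (k : ℝ)
  contraction : ∀ y : n → ℂ, ∑ j, ‖(y ᵥ* W) j‖ ^ 2 ≤ ∑ i, ‖y i‖ ^ 2

/-- One realignment of a two-versus-two product is of rank one, so its pairing is bounded
independently of `k`. -/
lemma pairing_le_of_factor {d k : ℕ} (hd : 2 ≤ d) {m : Type*} [Fintype m]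
    {R : m × m × m × m → ℂ}
    (s s' s'' : m × m × m × m ≃ (m × m) × (m × m)) {W W' W'' : Matrix (m × m) (m × m) ℂ}
    (hW : IsDual k W) (hW' : IsDual k W') (hW'' : IsDual k W'')
    (hR : ∃ u v : m × m → ℂ, (∀ x, R x = u (s x).1 * v (s x).2) ∧
      ∑ i, ‖u i‖ ^ 2 ≤ (d : ℝ) ^ 2 - 1 ∧ ∑ i, ‖v i‖ ^ 2 ≤ (d : ℝ) ^ 2 - 1) :
    (W * realign s R).trace.re + (W' * realign s' R).trace.re + (W'' * realign s'' R).trace.re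
      ≤ (d : ℝ) ^ 2 - 1 + 2 * √k * ((d : ℝ) ^ 2 - 1) := by
  obtain ⟨u, v, huv, hu, hv⟩ := hR
  have hd' : (2 : ℝ) ≤ d := by exact_mod_cast hd
  have h0 : (0 : ℝ) ≤ (d : ℝ) ^ 2 - 1 := by nlinarith
  have hF := sum_sq_le_of_factor s huv hu hv
  have h1 := re_trace_mul_le_rankOne hW.contraction (M := realign s R) (x := u) (y := v)
    (fun i j => by simp [realign, huv]) hu hv
  have h2 := re_trace_mul_le_frobenius hW'.frobenius ((sum_sq_realign s' R).trans_le hF)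
  have h3 := re_trace_mul_le_frobenius hW''.frobenius ((sum_sq_realign s'' R).trans_le hF)
  rw [Real.sqrt_mul_self h0] at h2 h3
  rw [Real.mul_self_sqrt h0] at h1
  linarith

/-- The bound on the pairings for a tensor of bounded Frobenius norm. -/
lemma pairing_le_of_sum_sq {d k : ℕ} (hd : 2 ≤ d) {m : Type*} [Fintype m]
    {R : m × m × m × m → ℂ}
    (s s' s'' : m × m × m × m ≃ (m × m) × (m × m)) {W W' W'' : Matrix (m × m) (m × m) ℂ}
    (hW : IsDual k W) (hW' : IsDual k W') (hW'' : IsDual k W'')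
    (hR : ∑ x, ‖R x‖ ^ 2 ≤ ((d : ℝ) - 1) * ((d : ℝ) ^ 3 - 3 * d + 2)) :
    (W * realign s R).trace.re + (W' * realign s' R).trace.re + (W'' * realign s'' R).trace.re
      ≤ 3 * (√k * ((d : ℝ) - 1) * √(((d : ℝ) - 1) * ((d : ℝ) + 2))) := by
  have hd' : (2 : ℝ) ≤ d := by exact_mod_cast hd
  have h1 := re_trace_mul_le_frobenius hW.frobenius ((sum_sq_realign s R).trans_le hR)
  have h2 := re_trace_mul_le_frobenius hW'.frobenius ((sum_sq_realign s' R).trans_le hR)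
  have h3 := re_trace_mul_le_frobenius hW''.frobenius ((sum_sq_realign s'' R).trans_le hR)
  rw [show ((d : ℝ) - 1) * ((d : ℝ) ^ 3 - 3 * d + 2)
      = ((d : ℝ) - 1) ^ 2 * (((d : ℝ) - 1) * ((d : ℝ) + 2)) by ring,
    Real.sqrt_mul (sq_nonneg _), Real.sqrt_sq (by linarith)] at h1 h2 h3
  linarith

/-- The bound on the three pairings for a biseparable pure state. -/
lemma pairing_le_of_bisepPure {d k : ℕ} (hd : 2 ≤ d) {L : m → Matrix (Fin d) (Fin d) ℂ}
    (hL : IsOpBasis (withOne L)) {W W' W'' : Matrix (m × m) (m × m) ℂ}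
    (hW : IsDual k W) (hW' : IsDual k W') (hW'' : IsDual k W'')
    {ψ : Fin d × Fin d × Fin d × Fin d → ℂ} (hψ : BisepPure ψ) :
    (W * realign (splitAB m) (corr L (outer ψ))).trace.re +
        (W' * realign (splitAC m) (corr L (outer ψ))).trace.re +
        (W'' * realign (splitAD m) (corr L (outer ψ))).trace.re ≤
      3 * max (((d : ℝ) ^ 2 - 1 + 2 * √k * ((d : ℝ) ^ 2 - 1)) / 3)
        (√k * ((d : ℝ) - 1) * √(((d : ℝ) - 1) * ((d : ℝ) + 2))) := by
  have hmax1 := le_max_left (((d : ℝ) ^ 2 - 1 + 2 * √k * ((d : ℝ) ^ 2 - 1)) / 3)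
    (√k * ((d : ℝ) - 1) * √(((d : ℝ) - 1) * ((d : ℝ) + 2)))
  have hmax2 := le_max_right (((d : ℝ) ^ 2 - 1 + 2 * √k * ((d : ℝ) ^ 2 - 1)) / 3)
    (√k * ((d : ℝ) - 1) * √(((d : ℝ) - 1) * ((d : ℝ) + 2)))
  have h13 := fun hR => pairing_le_of_sum_sq (R := corr L (outer ψ)) hd (splitAB m) (splitAC m)
    (splitAD m) hW hW' hW'' hR
  rcases hψ with ⟨φ, χ, hφ, hχ, h⟩ | ⟨φ, χ, hφ, hχ, h⟩ | ⟨φ, χ, hφ, hχ, h⟩ |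
    ⟨φ, χ, hφ, hχ, h⟩ | ⟨φ, χ, hφ, hχ, h⟩ | ⟨φ, χ, hφ, hχ, h⟩ | ⟨φ, χ, hφ, hχ, h⟩
  · have := h13 (sum_sq_corr_one_three hL (splitA (Fin d)) (splitA m) hφ hχ h
      (fun x p q => by simp [kron4, splitA]; ring))
    linarith
  · have := h13 (sum_sq_corr_one_three hL (splitB (Fin d)) (splitB m) hφ hχ h
      (fun x p q => by simp [kron4, splitB]; ring))
    linarith
  · have := h13 (sum_sq_corr_one_three hL (splitC (Fin d)) (splitC m) hφ hχ h
      (fun x p q => by simp [kron4, splitC]; ring))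
    linarith
  · have := h13 (sum_sq_corr_one_three hL (splitD (Fin d)) (splitD m) hφ hχ h
      (fun x p q => by simp [kron4, splitD]; ring))
    linarith
  · have := pairing_le_of_factor hd (splitAB m) (splitAC m) (splitAD m) hW hW' hW''
      (exists_factor_corr_two_two hL (splitAB (Fin d)) (splitAB m) hφ hχ h
        (fun x p q => by simp [kron4, splitAB]; ring))
    linarith
  · have := pairing_le_of_factor hd (splitAC m) (splitAB m) (splitAD m) hW' hW hW''
      (exists_factor_corr_two_two hL (splitAC (Fin d)) (splitAC m) hφ hχ h
        (fun x p q => by simp [kron4, splitAC]; ring))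
    linarith
  · have := pairing_le_of_factor hd (splitAD m) (splitAB m) (splitAC m) hW'' hW hW'
      (exists_factor_corr_two_two hL (splitAD (Fin d)) (splitAD m) hφ hχ h
        (fun x p q => by simp [kron4, splitAD]; ring))
    linarith

lemma re_trace_mul_realign_sum {d : ℕ} {m : Type*} [Fintype m]
    {L : m → Matrix (Fin d) (Fin d) ℂ}
    (s : m × m × m × m ≃ (m × m) × (m × m)) (W : Matrix (m × m) (m × m) ℂ) {ι : Type*}
    [Fintype ι] (p : ι → ℝ)
    (σ : ι → Matrix (Fin d × Fin d × Fin d × Fin d) (Fin d × Fin d × Fin d × Fin d) ℂ) :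
    (W * realign s (corr L (∑ a, (p a : ℂ) • σ a))).trace.re =
      ∑ a, p a * (W * realign s (corr L (σ a))).trace.re := by
  have h : realign s (corr L (∑ a, (p a : ℂ) • σ a)) =
      ∑ a, (p a : ℂ) • realign s (corr L (σ a)) := by
    ext i j
    simp [realign, corr, Finset.sum_mul, Matrix.trace_sum, Matrix.sum_apply]
  rw [h]
  simp [Finset.mul_sum, Matrix.trace_sum]

end CorrelationTensor

/-- Theorem 4.2: if for some `k` the average Ky Fan `k`-norm of the three two-vs-two
realignments of the four-body correlation tensor of a four-qudit state exceeds
`max{(d²-1+2√k(d²-1))/3, √k (d-1) √((d-1)(d+2))}`, then the state is genuinely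
multipartite entangled (i.e. not biseparable). -/
theorem gme_criterion (d : ℕ) (hd : 2 ≤ d)
    (lam : Fin (d ^ 2 - 1) → Matrix (Fin d) (Fin d) ℂ)
    (hherm : ∀ i, (lam i).IsHermitian)
    (htr0 : ∀ i, (lam i).trace = 0)
    (horth : ∀ i j, (lam i * lam j).trace = if i = j then (d : ℂ) else 0)
    (ρ : Matrix (Fin d × Fin d × Fin d × Fin d) (Fin d × Fin d × Fin d × Fin d) ℂ)
    (hpsd : ρ.PosSemidef) (htr1 : ρ.trace = 1)
    (k : ℕ) (hk1 : 1 ≤ k) (hk2 : k ≤ (d ^ 2 - 1) ^ 2)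
    (hgt :
      (kyFan k (MABCD lam ρ) + kyFan k (MACBD lam ρ) + kyFan k (MADBC lam ρ)) / 3 >
        max (((d : ℝ) ^ 2 - 1 + 2 * Real.sqrt k * ((d : ℝ) ^ 2 - 1)) / 3)
          (Real.sqrt k * ((d : ℝ) - 1) * Real.sqrt (((d : ℝ) - 1) * ((d : ℝ) + 2)))) :
    ¬ Biseparable ρ := by
  rintro ⟨n, p, ψ, hp, hp1, hψ, rfl⟩
  have hL := isOpBasis_withOne hd hherm htr0 horth
  obtain ⟨W, hW, hWF, hWc⟩ := exists_kyFan_eq_trace k (MABCD lam (∑ α, (p α : ℂ) • outer (ψ α)))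
  obtain ⟨W', hW', hWF', hWc'⟩ :=
    exists_kyFan_eq_trace k (MACBD lam (∑ α, (p α : ℂ) • outer (ψ α)))
  obtain ⟨W'', hW'', hWF'', hWc''⟩ :=
    exists_kyFan_eq_trace k (MADBC lam (∑ α, (p α : ℂ) • outer (ψ α)))
  have h1 := hW.trans (re_trace_mul_realign_sum (splitAB _) W p fun α => outer (ψ α))
  have h2 := hW'.trans (re_trace_mul_realign_sum (splitAC _) W' p fun α => outer (ψ α))
  have h3 := hW''.trans (re_trace_mul_realign_sum (splitAD _) W'' p fun α => outer (ψ α))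
  rw [h1, h2, h3, ← Finset.sum_add_distrib, ← Finset.sum_add_distrib] at hgt
  refine absurd hgt (not_lt.2 ?_)
  rw [div_le_iff₀ (by norm_num)]
  have key := Finset.sum_le_sum fun α (_ : α ∈ Finset.univ) =>
    mul_le_mul_of_nonneg_left
      (pairing_le_of_bisepPure hd hL ⟨hWF, hWc⟩ ⟨hWF', hWc'⟩ ⟨hWF'', hWc''⟩ (hψ α)) (hp α)
  rw [← Finset.sum_mul, hp1, one_mul] at key
  exact (Finset.sum_congr rfl fun α _ => by ring).trans_le (key.trans_eq (mul_comm _ _))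

end SpinCorrGME
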